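/- arXiv:2111.08855 — 3 statements merged into one kernel-verified Lean document; each statement's English description precedes it below -/
import Mathlib

section
/- If f : A → A is a C¹ diffeomorphism of the standard annulus which maps each boundary component to itself, is a twist map, and admits a positive integral invariant, then f has at least one fixed point. -/
open Set MeasureTheory

noncomputable section

/-- The cylinder `(ℝ/ℤ) × ℝ`, in which the standard annulus sits. -/
abbrev Cyl : Type := AddCircle (1 : ℝ) × ℝ

/-- The standard annulus `A = (ℝ/ℤ) × [0,1]`, viewed inside the cylinder. -/
def annA : Set Cyl := Set.univ ×ˢ Set.Icc (0 : ℝ) 1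

/-- The universal cover `Ã = ℝ × [0,1]`, viewed inside `ℝ²`. -/
def stripA : Set (ℝ × ℝ) := Set.univ ×ˢ Set.Icc (0 : ℝ) 1

/-- The covering projection `π(x, y) = (x mod 1, y)`. -/
def covProj (p : ℝ × ℝ) : Cyl := ((p.1 : AddCircle (1 : ℝ)), p.2)




lemma exists_angle (Φ : ℝ × ℝ → ℝ × ℝ) (hc : Continuous Φ) (h0 : ∀ p, Φ p ≠ 0) :
    ∃ θ : ℝ × ℝ → ℝ, Continuous θ ∧ ∀ p, ∃ r : ℝ, 0 < r ∧
      (Φ p).1 = r * Real.cos (θ p) ∧ (Φ p).2 = r * Real.sin (θ p) := by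
  let g : C(ℝ × ℝ, ℂ) := ⟨fun p => Complex.equivRealProdCLM.symm (Φ p), by fun_prop⟩
  have hg0 : ∀ p, g p ≠ 0 := fun p h => h0 p (by
    simpa [g] using h)
  obtain ⟨L, ⟨-, hL⟩, -⟩ := Complex.isCoveringMapOn_exp.existsUnique_continuousMap_lifts
    (f := g) (a₀ := (0 : ℝ × ℝ)) (e₀ := Complex.log (g 0)) (by
      simpa using Complex.exp_log (hg0 0)) (by
      intro p; simpa using hg0 p)
  refine ⟨fun p => (L p).im, by fun_prop, fun p => ⟨Real.exp (L p).re, Real.exp_pos _, ?_, ?_⟩⟩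
  · have h := congrArg Complex.re (congrFun hL p)
    simpa [Complex.exp_re, g] using h.symm
  · have h := congrArg Complex.im (congrFun hL p)
    simpa [Complex.exp_im, g] using h.symm

/-- a continuous angle with positive sine along an interval stays in `(0, π)`. -/
lemma angle_stays (α : ℝ → ℝ) (a b : ℝ) (hab : a ≤ b) (hc : ContinuousOn α (Icc a b))
    (hs : ∀ t ∈ Icc a b, 0 < Real.sin (α t)) (h0 : 0 < α a) (h1 : α a < Real.pi) :
    0 < α b ∧ α b < Real.pi := by
  constructor
  · by_contra! h
    obtain ⟨t, ht, hta⟩ := intermediate_value_Icc' hab hc (show (0 : ℝ) ∈ Icc (α b) (α a) from ⟨h, h0.le⟩)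
    have := hs t ht
    rw [hta] at this; simp at this
  · by_contra! h
    obtain ⟨t, ht, hta⟩ := intermediate_value_Icc hab hc (show Real.pi ∈ Icc (α a) (α b) from ⟨h1.le, h⟩)
    have := hs t ht
    rw [hta] at this; simp at this

lemma interp (n : ℕ) (c d : ℕ → ℝ) (ε : ℝ) (hε : 0 ≤ ε)
    (hinj : ∀ i < n, ∀ j < n, c i = c j → i = j) (hd : ∀ i < n, |d i| ≤ ε) :
    ∃ a : ℝ → ℝ, Continuous a ∧ (∀ x, |a x| ≤ ε) ∧ ∀ i < n, a (c i) = d i := by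
  let P := Lagrange.interpolate (Finset.range n) c d
  refine ⟨fun x => max (-ε) (min ε (P.eval x)), by fun_prop, ?_, ?_⟩
  · intro x
    rw [abs_le]
    exact ⟨le_max_left _ _, max_le (by linarith) (min_le_left _ _)⟩
  · intro i hi
    have : P.eval (c i) = d i := Lagrange.eval_interpolate_at_node d
      (by intro x hx y hy h; exact hinj x (by simpa using hx) y (by simpa using hy) h) (by simpa using hi)
    have h2 := abs_le.1 (hd i hi)
    simp only [this]
    rw [min_eq_right h2.2, max_eq_right h2.1]

lemma path_exists (Gm : ℝ × ℝ → ℝ × ℝ) (hGc : Continuous Gm) (hGi : Function.Injective Gm)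
    (ε : ℝ) (hε : 0 < ε) (b : ℝ → ℝ) (hb : ∀ x, |b x| ≤ ε) (w : ℝ × ℝ) (hw : w.2 = -2 * ε)
    (hlow : ∀ z : ℝ × ℝ, -2 * ε ≤ z.2 → -ε / 2 + b (Gm z).1 ≤ (Gm z).2)
    (hGw : (Gm w).2 = -ε / 2 + b (Gm w).1) :
    ∃ γ : ℝ → ℝ × ℝ, (∀ n : ℕ, ContinuousOn γ (Icc 0 n)) ∧ (∀ n : ℕ, γ n = Gm^[n] w) ∧
      (∀ t, 0 ≤ t → γ (t + 1) = Gm (γ t)) ∧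
      (∀ s t, 0 ≤ s → s + 1 ≤ t → γ t ≠ γ s) ∧
      (∀ t, 0 ≤ t → t ≤ 1 → (γ t).2 ≤ ε / 2) ∧
      (∀ t, 1 ≤ t → -2 * ε < (γ t).2) := by
  have hb' : ∀ x, -ε ≤ b x ∧ b x ≤ ε := fun x => abs_le.1 (hb x)
  set g0 : ℝ → ℝ × ℝ := fun t => (w.1 + min (2 * t) 1 * ((Gm w).1 - w.1),
    -2 * ε + max (2 * t - 1) 0 * ((Gm w).2 + 2 * ε)) with hg0
  have hg0c : Continuous g0 := by fun_prop
  have hg00 : g0 0 = w := by ext <;> simp [hg0, hw]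
  have hg01 : g0 1 = Gm w := by
    ext
    · simp only [hg0]; norm_num
    · simp only [hg0]; norm_num
  have hy : -3 / 2 * ε ≤ (Gm w).2 ∧ (Gm w).2 ≤ ε / 2 := by
    have := hb' (Gm w).1
    constructor <;> linarith
  have hg0low : ∀ t, -2 * ε ≤ (g0 t).2 := by
    intro t
    have : 0 ≤ max (2 * t - 1) 0 * ((Gm w).2 + 2 * ε) :=
      mul_nonneg (le_max_right _ _) (by linarith)
    simp only [hg0]; linarith
  have hg0up : ∀ t, t ≤ 1 → (g0 t).2 ≤ ε / 2 := by
    intro t ht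
    have h1 : max (2 * t - 1) 0 ≤ 1 := max_le (by linarith) (by norm_num)
    have : max (2 * t - 1) 0 * ((Gm w).2 + 2 * ε) ≤ 1 * ((Gm w).2 + 2 * ε) :=
      mul_le_mul_of_nonneg_right h1 (by linarith)
    simp only [hg0]; linarith
  have hGlow : ∀ z : ℝ × ℝ, -2 * ε ≤ z.2 → -2 * ε < (Gm z).2 := by
    intro z hz
    have h1 := hlow z hz
    have h2 := hb' (Gm z).1
    linarith
  have hg0not : ∀ s, 0 ≤ s → s < 1 → ∀ z : ℝ × ℝ, -2 * ε ≤ z.2 → Gm z ≠ g0 s := by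
    intro s hs0 hs1 z hz heq
    rcases le_or_gt s (1 / 2) with h | h
    · have : (g0 s).2 = -2 * ε := by
        simp only [hg0]; rw [max_eq_right (by linarith)]; ring
      have h2 := hGlow z hz
      rw [heq, this] at h2
      exact lt_irrefl _ h2
    · have hx : (g0 s).1 = (Gm w).1 := by
        simp only [hg0]; rw [min_eq_right (by linarith)]; ring
      have hyy : (g0 s).2 < (Gm w).2 := by
        simp only [hg0]; rw [max_eq_left (by linarith)]
        nlinarith
      have h2 := hlow z hz
      rw [heq, hx, ← hGw] at h2
      linarith
  set γ : ℝ → ℝ × ℝ := fun t => Gm^[⌊t⌋₊] (g0 (t - ⌊t⌋₊)) with hγ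
  have hsucc : ∀ t, 0 ≤ t → γ (t + 1) = Gm (γ t) := by
    intro t ht
    simp only [hγ]
    rw [Nat.floor_add_one ht, Function.iterate_succ_apply']
    congr 3
    push_cast; ring
  have hnat : ∀ n : ℕ, γ n = Gm^[n] w := by
    intro n; simp [hγ, hg00]
  have hbase' : ∀ t, 0 ≤ t → t < 1 → γ t = g0 t := by
    intro t h0 h1
    simp [hγ, Nat.floor_eq_zero.2 h1]
  have hbase : ∀ t, 0 ≤ t → t ≤ 1 → γ t = g0 t := by
    intro t h0 h1
    rcases h1.lt_or_eq with h | h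
    · exact hbase' t h0 h
    · subst h
      rw [hg01]; simpa using hnat 1
  have hγlow : ∀ t, 0 ≤ t → -2 * ε ≤ (γ t).2 := by
    intro t _
    have key : ∀ (k : ℕ) (p : ℝ × ℝ), -2 * ε ≤ p.2 → -2 * ε ≤ (Gm^[k] p).2 := by
      intro k p hp
      induction k with
      | zero => exact hp
      | succ k ih =>
        rw [Function.iterate_succ_apply']
        exact (hGlow _ ih).le
    exact key _ _ (hg0low _)
  refine ⟨γ, ?_, hnat, hsucc, ?_, ?_, ?_⟩
  · intro n
    induction n with
    | zero => simp
    | succ n ih =>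
      have hset : Icc (0 : ℝ) ((n + 1 : ℕ) : ℝ) = Icc 0 1 ∪ Icc 1 ((n + 1 : ℕ) : ℝ) := by
        rw [Icc_union_Icc_eq_Icc (by norm_num) (by push_cast; linarith [n.cast_nonneg (α := ℝ)])]
      rw [hset]
      refine ContinuousOn.union_of_isClosed ?_ ?_ isClosed_Icc isClosed_Icc
      · exact hg0c.continuousOn.congr (fun t ht => hbase t ht.1 ht.2)
      · have : ContinuousOn (fun t => Gm (γ (t - 1))) (Icc 1 ((n + 1 : ℕ) : ℝ)) := by
          refine hGc.comp_continuousOn (ih.comp (by fun_prop) ?_)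
          intro t ht
          have h1 := ht.1
          have h2 := ht.2
          push_cast at h2
          constructor <;> simp <;> linarith
        refine this.congr (fun t ht => ?_)
        have := hsucc (t - 1) (by linarith [ht.1])
        simpa using this
  · have key : ∀ k : ℕ, ∀ s t : ℝ, 0 ≤ s → s < k + 1 → s + 1 ≤ t → γ t ≠ γ s := by
      intro k
      induction k with
      | zero =>
        intro s t hs0 hs1 hst heq
        have h1 : γ t = Gm (γ (t - 1)) := by
          simpa using hsucc (t - 1) (by linarith)
        rw [h1, hbase s hs0 (by simpa using hs1.le)] at heq
        exact hg0not s hs0 (by simpa using hs1) _ (hγlow _ (by linarith)) heq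
      | succ k ih =>
        intro s t hs0 hs1 hst heq
        rcases lt_or_ge s (k + 1) with h | h
        · exact ih s t hs0 h hst heq
        · have hs : 1 ≤ s := by linarith [k.cast_nonneg (α := ℝ)]
          have h1 : γ t = Gm (γ (t - 1)) := by
            simpa using hsucc (t - 1) (by linarith)
          have h2 : γ s = Gm (γ (s - 1)) := by
            simpa using hsucc (s - 1) (by linarith)
          rw [h1, h2] at heq
          push_cast at hs1
          exact ih (s - 1) (t - 1) (by linarith) (by linarith) (by linarith) (hGi heq)
    intro s t hs hst
    exact key ⌊s⌋₊ s t hs (Nat.lt_floor_add_one s) hst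
  · intro t h0 h1
    rw [hbase t h0 h1]; exact hg0up t h1
  · intro t ht
    have h1 : γ t = Gm (γ (t - 1)) := by
      simpa using hsucc (t - 1) (by linarith)
    rw [h1]
    exact hGlow _ (hγlow _ (by linarith))

lemma core_rotation (Gm : ℝ × ℝ → ℝ × ℝ) (hGc : Continuous Gm) (hGi : Function.Injective Gm)
    (ε : ℝ) (hε : 0 < ε) (b : ℝ → ℝ) (hb : ∀ x, |b x| ≤ ε) (w : ℝ × ℝ) (hw : w.2 = -2 * ε)
    (hlow : ∀ z : ℝ × ℝ, -2 * ε ≤ z.2 → -ε / 2 + b (Gm z).1 ≤ (Gm z).2)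
    (hGw : (Gm w).2 = -ε / 2 + b (Gm w).1)
    (θ : ℝ × ℝ → ℝ) (hθ : Continuous θ)
    (hpos : ∀ z, 0 < Real.cos (θ z) * ((Gm z).1 - z.1) + Real.sin (θ z) * ((Gm z).2 - z.2))
    (htop : ∀ z : ℝ × ℝ, z.2 < 1 → (Gm z).2 ≤ 1 + ε)
    (n : ℕ) (hn : 1 + 2 * ε ≤ (Gm^[n] w).2)
    (hcw : Real.cos (θ w) = -1) (hct : ∀ z : ℝ × ℝ, 1 ≤ z.2 → Real.cos (θ z) = 1) :
    ∃ z : ℝ × ℝ, 1 ≤ z.2 ∧ θ z = θ w - Real.pi := by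
  obtain ⟨γ, hγc, hγn, hγs, hγne, hγ1, hγlow⟩ :=
    path_exists Gm hGc hGi ε hε b hb w hw hlow hGw
  have hγ0 : γ 0 = w := by simpa using hγn 0
  -- first hitting time
  have hcomp : IsCompact (Icc (0 : ℝ) n ∩ {t | 1 + 2 * ε ≤ (γ t).2}) := by
    have hcl : IsClosed (Icc (0 : ℝ) n ∩ (fun t => (γ t).2) ⁻¹' (Ici (1 + 2 * ε))) :=
      ContinuousOn.preimage_isClosed_of_isClosed (continuous_snd.comp_continuousOn (hγc n))
        isClosed_Icc isClosed_Ici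
    exact isCompact_Icc.of_isClosed_subset hcl inter_subset_left
  obtain ⟨τ, ⟨⟨hτ0, hτn⟩, hτy⟩, hτmin⟩ := hcomp.exists_isLeast
    ⟨(n : ℝ), ⟨⟨by positivity, le_refl _⟩, by simpa [hγn n] using hn⟩⟩
  have hτy : 1 + 2 * ε ≤ (γ τ).2 := hτy
  have hbefore : ∀ s, 0 ≤ s → s < τ → (γ s).2 < 1 + 2 * ε := by
    intro s h0 hs
    by_contra! h
    exact absurd (hτmin ⟨⟨h0, by linarith⟩, h⟩) (not_le.2 hs)
  have hτ1 : 1 < τ := by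
    by_contra! h
    have := hγ1 τ hτ0 h
    linarith
  -- continuous extension of the path
  set γc : ℝ → ℝ × ℝ := fun t => γ (max 0 (min t n)) with hγcdef
  have hγcc : Continuous γc := by
    have : ContinuousOn γ (Icc (0:ℝ) n) := hγc n
    refine this.comp_continuous (by fun_prop) (fun t => ⟨le_max_left _ _, max_le (by positivity) (min_le_right _ _)⟩)
  have hγceq : ∀ t, 0 ≤ t → t ≤ τ → γc t = γ t := by
    intro t h0 h1
    simp only [hγcdef]
    rw [min_eq_left (by linarith), max_eq_right h0]
  set S : ℝ × ℝ → ℝ := fun p => max 0 (min p.1 (τ - 1)) with hS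
  set T : ℝ × ℝ → ℝ := fun p => max (S p + 1) (min p.2 τ) with hT
  have hS0 : ∀ p, 0 ≤ S p := fun p => le_max_left _ _
  have hS1 : ∀ p, S p ≤ τ - 1 := fun p => max_le (by linarith) (min_le_right _ _)
  have hT0 : ∀ p, S p + 1 ≤ T p := fun p => le_max_left _ _
  have hT1 : ∀ p, T p ≤ τ := fun p => max_le (by linarith [hS1 p]) (min_le_right _ _)
  have hScont : Continuous S := by fun_prop
  have hTcont : Continuous T := by fun_prop
  have hΦc : Continuous (fun p => γc (T p) - γc (S p)) := by fun_prop
  have hΦ : ∀ p, γc (T p) - γc (S p) = γ (T p) - γ (S p) := by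
    intro p
    rw [hγceq _ (by linarith [hS0 p, hT0 p]) (hT1 p), hγceq _ (hS0 p) (by linarith [hS1 p])]
  obtain ⟨α, hαc, hα⟩ := exists_angle (fun p => γc (T p) - γc (S p)) hΦc (by
    intro p h
    simp only [hΦ] at h
    exact hγne _ _ (hS0 p) (hT0 p) (sub_eq_zero.1 h))
  simp only [hΦ] at hα
  -- the relevant values
  have hval : ∀ s t, 0 ≤ s → s + 1 ≤ t → t ≤ τ → S (s, t) = s ∧ T (s, t) = t := by
    intro s t h0 h1 h2
    have : S (s, t) = s := by
      simp only [hS]; rw [min_eq_left (by linarith), max_eq_right h0]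
    refine ⟨this, ?_⟩
    simp only [hT]; rw [this, min_eq_left h2, max_eq_right h1]
  have hα' : ∀ s t, 0 ≤ s → s + 1 ≤ t → t ≤ τ → ∃ r : ℝ, 0 < r ∧
      (γ t).1 - (γ s).1 = r * Real.cos (α (s, t)) ∧ (γ t).2 - (γ s).2 = r * Real.sin (α (s, t)) := by
    intro s t h0 h1 h2
    obtain ⟨r, hr, e1, e2⟩ := hα (s, t)
    rw [(hval s t h0 h1 h2).1, (hval s t h0 h1 h2).2] at e1 e2
    exact ⟨r, hr, by simpa using e1, by simpa using e2⟩
  have hcosdiff : ∀ t, 0 ≤ t → t + 1 ≤ τ → 0 < Real.cos (θ (γ t) - α (t, t + 1)) := by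
    intro t h0 h1
    obtain ⟨r, hr, e1, e2⟩ := hα' t (t + 1) h0 le_rfl h1
    have := hpos (γ t)
    rw [← hγs t h0, e1, e2] at this
    rw [Real.cos_sub]
    by_contra! h
    nlinarith
  have hsin1 : ∀ t, 1 ≤ t → t ≤ τ → 0 < Real.sin (α (0, t)) := by
    intro t h0 h1
    obtain ⟨r, hr, e1, e2⟩ := hα' 0 t le_rfl (by linarith) h1
    have h2 := hγlow t h0
    rw [hγ0, hw] at e2
    by_contra! h
    nlinarith
  have hsin2 : ∀ s, 0 ≤ s → s ≤ τ - 1 → 0 < Real.sin (α (s, τ)) := by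
    intro s h0 h1
    obtain ⟨r, hr, e1, e2⟩ := hα' s τ h0 (by linarith) le_rfl
    have h2 := hbefore s h0 (by linarith)
    by_contra! h
    nlinarith
  -- normalise
  obtain ⟨m, hm⟩ : ∃ m : ℤ, θ w - Real.pi = m * (2 * Real.pi) := by
    have h1 : Real.cos (θ w - Real.pi) = 1 := by rw [Real.cos_sub_pi, hcw]; norm_num
    obtain ⟨m, hm⟩ := (Real.cos_eq_one_iff _).1 h1
    exact ⟨m, hm.symm⟩
  have hpi := Real.pi_pos
  -- choose the branch of α near θ w at (0,1)
  obtain ⟨k, hk1, hk2⟩ : ∃ k : ℤ, -(Real.pi / 2) < θ w - (α (0, 1) + k * (2 * Real.pi)) ∧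
      θ w - (α (0, 1) + k * (2 * Real.pi)) < Real.pi / 2 := by
    have h1 := hcosdiff 0 le_rfl (by linarith)
    rw [hγ0, zero_add] at h1
    set x := θ w - α (0, 1) with hx
    obtain ⟨k, hk⟩ : ∃ k : ℤ, x - k * (2 * Real.pi) ∈ Ioc (-Real.pi) (-Real.pi + 2 * Real.pi) := by
      obtain ⟨k, hk, -⟩ := existsUnique_sub_zsmul_mem_Ioc (Real.two_pi_pos) x (-Real.pi)
      exact ⟨k, by simpa using hk⟩
    have h2 : 0 < Real.cos (x - k * (2 * Real.pi)) := by
      rw [Real.cos_sub_int_mul_two_pi]; exact h1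
    have h3 : |x - k * (2 * Real.pi)| < Real.pi / 2 := by
      by_contra! h
      have h4 : |x - k * (2 * Real.pi)| ≤ Real.pi := abs_le.2 ⟨hk.1.le, by linarith [hk.2]⟩
      have := Real.cos_nonpos_of_pi_div_two_le_of_le h (by linarith)
      rw [Real.cos_abs] at this
      linarith
    rw [abs_lt] at h3
    exact ⟨k, by linarith [h3.1], by linarith [h3.2]⟩
  set β : ℝ × ℝ → ℝ := fun p => α p + ((k - m : ℤ) : ℝ) * (2 * Real.pi) with hβ
  have hβc : Continuous β := by fun_prop
  have hβsin : ∀ p, Real.sin (β p) = Real.sin (α p) := fun p => Real.sin_add_int_mul_two_pi _ _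
  have hβ01 : Real.pi / 2 < β (0, 1) ∧ β (0, 1) < 3 * Real.pi / 2 := by
    simp only [hβ]; push_cast
    constructor <;> linarith
  have hβ01' : β (0, 1) < Real.pi := by
    by_contra! h
    have h1 := hsin1 1 le_rfl hτ1.le
    rw [← hβsin] at h1
    have h2 : Real.sin (β (0, 1) - Real.pi) < 0 := by rw [Real.sin_sub_pi]; linarith
    have h3 := Real.sin_nonneg_of_nonneg_of_le_pi (x := β (0, 1) - Real.pi) (by linarith) (by linarith)
    linarith
  have hA := angle_stays (fun t => β (0, t)) 1 τ hτ1.le (by fun_prop)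
    (fun t ht => by simp only [hβsin]; exact hsin1 t ht.1 ht.2) (show (0:ℝ) < β (0, 1) by linarith) hβ01'
  have hB := angle_stays (fun s => β (s, τ)) 0 (τ - 1) (by linarith) (by fun_prop)
    (fun t ht => by simp only [hβsin]; exact hsin2 t ht.1 ht.2) hA.1 hA.2
  have hγτ : ContinuousOn γ (Icc 0 (τ - 1)) := (hγc n).mono (Icc_subset_Icc le_rfl (by linarith))
  have hC := angle_stays
    (fun t => θ (γ t) - m * (2 * Real.pi) - β (t, t + 1) + Real.pi / 2) 0 (τ - 1) (by linarith)
    (by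
      have : ContinuousOn (fun t => θ (γ t)) (Icc 0 (τ - 1)) := hθ.comp_continuousOn hγτ
      have h2 : ContinuousOn (fun t : ℝ => β (t, t + 1)) (Icc 0 (τ - 1)) := by fun_prop
      exact ((this.sub continuousOn_const).sub h2).add continuousOn_const)
    (fun t ht => by
      rw [Real.sin_add_pi_div_two]
      have h1 := hcosdiff t ht.1 (by linarith [ht.2])
      have : θ (γ t) - m * (2 * Real.pi) - β (t, t + 1) =
        θ (γ t) - α (t, t + 1) - (k : ℤ) * (2 * Real.pi) := by
        simp only [hβ]; push_cast; ring
      rw [this, Real.cos_sub_int_mul_two_pi]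
      exact h1)
    (by simp only [zero_add, hγ0]; simp only [hβ]; push_cast; linarith)
    (by simp only [zero_add, hγ0]; simp only [hβ]; push_cast; linarith)
  simp only [sub_add_cancel] at hC hB
  have htopz : 1 ≤ (γ (τ - 1)).2 := by
    by_contra! h
    have h1 := htop _ h
    rw [← hγs _ (by linarith), sub_add_cancel] at h1
    linarith
  refine ⟨γ (τ - 1), htopz, ?_⟩
  obtain ⟨j, hj⟩ := (Real.cos_eq_one_iff _).1 (hct _ htopz)
  rw [hm, ← hj]
  rw [← hj] at hC
  have h1 : ((j - m : ℤ) : ℝ) * (2 * Real.pi) < 1 * (2 * Real.pi) := by push_cast; linarith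
  have h2 : (-1) * (2 * Real.pi) < ((j - m : ℤ) : ℝ) * (2 * Real.pi) := by push_cast; linarith
  have h1' := lt_of_mul_lt_mul_right h1 (by positivity)
  have h2' := lt_of_mul_lt_mul_right h2 (by positivity)
  have h3 : j - m < 1 := by exact_mod_cast h1'
  have h4 : -1 < j - m := by exact_mod_cast h2'
  have : j = m := by omega
  rw [this]


lemma mem_stripA {p : ℝ × ℝ} : p ∈ stripA ↔ 0 ≤ p.2 ∧ p.2 ≤ 1 := by simp [stripA]

lemma generic_pt (F G : ℝ × ℝ → ℝ × ℝ) (hFm : MapsTo F stripA stripA)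
    (hGm : MapsTo G stripA stripA) (hGc : ContinuousOn G stripA)
    (hGF : ∀ p ∈ stripA, G (F p) = p) (hFG : ∀ p ∈ stripA, F (G p) = p)
    (z : ℝ × ℝ) (hz : z ∈ stripA) (η : ℝ) (hη : 0 < η) (S1 S2 : Set ℝ) (h1 : S1.Finite)
    (h2 : S2.Finite) :
    ∃ z' ∈ stripA, dist z' z < η ∧ z'.1 ∉ S1 ∧ (F z').2 ∉ S2 := by
  obtain ⟨x, hx, hxS⟩ : ((Ioo z.1 (z.1 + η)) \ S1).Nonempty :=
    ((Ioo_infinite (by linarith)).sdiff h1).nonempty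
  set z1 : ℝ × ℝ := (x, z.2) with hz1
  have hz1s : z1 ∈ stripA := mem_stripA.2 (mem_stripA.1 hz)
  have hz1d : dist z1 z < η := by
    rw [Prod.dist_eq]
    simp only [hz1, dist_self]
    refine max_lt ?_ hη
    rw [Real.dist_eq, abs_lt]
    constructor <;> linarith [hx.1, hx.2]
  have hopen : {p : ℝ × ℝ | dist p z < η ∧ p.1 ∉ S1} ∈ nhds (G (F z1)) := by
    rw [hGF _ hz1s]
    refine Filter.inter_mem ?_ ?_
    · exact Metric.isOpen_ball.mem_nhds hz1d
    · exact (h1.isClosed.isOpen_compl.preimage continuous_fst).mem_nhds hxS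
  have hcont := (hGc (F z1) (hFm hz1s)) hopen
  rw [Filter.mem_map, Metric.mem_nhdsWithin_iff] at hcont
  obtain ⟨ρ, hρ, hsub⟩ := hcont
  set y := (F z1).2 with hy
  have hy01 := mem_stripA.1 (hFm hz1s)
  obtain ⟨y', hy'0, hy'1, hy'd, hy'S⟩ : ∃ y', 0 ≤ y' ∧ y' ≤ 1 ∧ |y' - y| < ρ ∧ y' ∉ S2 := by
    rcases le_or_gt y (1 / 2) with h | h
    · obtain ⟨t, ht, htS⟩ : ((Ioo y (y + min ρ (1 / 2))) \ S2).Nonempty :=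
        ((Ioo_infinite (by linarith [lt_min hρ (show (0:ℝ) < 1 / 2 by norm_num)])).sdiff h2).nonempty
      have a1 := min_le_left ρ (1 / 2)
      have a2 := min_le_right ρ (1 / 2)
      exact ⟨t, by linarith [ht.1, hy01.1], by linarith [ht.2],
        by rw [abs_lt]; constructor <;> linarith [ht.1, ht.2], htS⟩
    · obtain ⟨t, ht, htS⟩ : ((Ioo (y - min ρ (1 / 2)) y) \ S2).Nonempty :=
        ((Ioo_infinite (by linarith [lt_min hρ (show (0:ℝ) < 1 / 2 by norm_num)])).sdiff h2).nonempty
      have a1 := min_le_left ρ (1 / 2)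
      have a2 := min_le_right ρ (1 / 2)
      exact ⟨t, by linarith [ht.1], by linarith [ht.2, hy01.2],
        by rw [abs_lt]; constructor <;> linarith [ht.1, ht.2], htS⟩
  have hq : ((F z1).1, y') ∈ stripA := mem_stripA.2 ⟨hy'0, hy'1⟩
  have := hsub ⟨show ((F z1).1, y') ∈ Metric.ball (F z1) ρ by
    rw [Metric.mem_ball, Prod.dist_eq]
    simpa [Real.dist_eq] using hy'd, hq⟩
  exact ⟨G ((F z1).1, y'), hGm hq, this.1, this.2, by rw [hFG _ hq]; exact hy'S⟩

lemma generic_seq (F G : ℝ × ℝ → ℝ × ℝ) (hFm : MapsTo F stripA stripA)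
    (hGm : MapsTo G stripA stripA) (hGc : ContinuousOn G stripA)
    (hGF : ∀ p ∈ stripA, G (F p) = p) (hFG : ∀ p ∈ stripA, F (G p) = p)
    (z : ℕ → ℝ × ℝ) (hz : ∀ i, z i ∈ stripA) (η : ℕ → ℝ) (hη : ∀ i, 0 < η i) (n : ℕ) :
    ∃ z' : ℕ → ℝ × ℝ, (∀ i < n, z' i ∈ stripA ∧ dist (z' i) (z i) < η i) ∧
      (∀ i < n, ∀ j < n, (z' i).1 = (z' j).1 → i = j) ∧
      (∀ i < n, ∀ j < n, (F (z' i)).2 = (F (z' j)).2 → i = j) := by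
  induction n with
  | zero => exact ⟨z, by simp, by simp, by simp⟩
  | succ n ih =>
    obtain ⟨z', h1, h2, h3⟩ := ih
    obtain ⟨p, hp, hpd, hp1, hp2⟩ := generic_pt F G hFm hGm hGc hGF hFG (z n) (hz n) (η n) (hη n)
      ((fun i => (z' i).1) '' (Iio n)) ((fun i => (F (z' i)).2) '' (Iio n))
      ((finite_Iio n).image _) ((finite_Iio n).image _)
    have hup : ∀ i, i < n → Function.update z' n p i = z' i := fun i hi =>
      Function.update_of_ne hi.ne _ _
    refine ⟨Function.update z' n p, ?_, ?_, ?_⟩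
    · intro i hi
      rcases Nat.lt_succ_iff_lt_or_eq.1 hi with h | h
      · rw [hup i h]; exact h1 i h
      · subst h; simp [hp, hpd]
    · intro i hi j hj
      rcases Nat.lt_succ_iff_lt_or_eq.1 hi with h | h <;>
        rcases Nat.lt_succ_iff_lt_or_eq.1 hj with h' | h'
      · rw [hup i h, hup j h']; exact h2 i h j h'
      · subst h'; rw [hup i h, Function.update_self]
        exact fun e => absurd ⟨i, h, e⟩ hp1
      · subst h; rw [hup j h', Function.update_self]
        exact fun e => absurd ⟨j, h', e.symm⟩ hp1
      · intro _; omega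
    · intro i hi j hj
      rcases Nat.lt_succ_iff_lt_or_eq.1 hi with h | h <;>
        rcases Nat.lt_succ_iff_lt_or_eq.1 hj with h' | h'
      · rw [hup i h, hup j h']; exact h3 i h j h'
      · subst h'; rw [hup i h, Function.update_self]
        exact fun e => absurd ⟨i, h, e⟩ hp2
      · subst h; rw [hup j h', Function.update_self]
        exact fun e => absurd ⟨j, h', e.symm⟩ hp2
      · intro _; omega

/-- clamp a point of the plane to the strip -/
def clampS (z : ℝ × ℝ) : ℝ × ℝ := (z.1, max 0 (min z.2 1))

/-- extension of a strip map to the plane, with expansion away from the strip at the top and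
contraction towards the strip at the bottom -/
def extF (F : ℝ × ℝ → ℝ × ℝ) (z : ℝ × ℝ) : ℝ × ℝ :=
  ((F (clampS z)).1, (F (clampS z)).2 + (min z.2 0 / 4 + 4 * max (z.2 - 1) 0))

lemma clampS_mem (z : ℝ × ℝ) : clampS z ∈ stripA :=
  mem_stripA.2 ⟨le_max_left _ _, max_le (by norm_num) (min_le_right _ _)⟩

lemma continuous_clampS : Continuous clampS := by unfold clampS; fun_prop

lemma clampS_of_mem {z : ℝ × ℝ} (hz : z ∈ stripA) : clampS z = z := by
  have := mem_stripA.1 hz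
  ext
  · rfl
  · simp only [clampS]; rw [min_eq_left this.2, max_eq_right this.1]

lemma clampS_low {z : ℝ × ℝ} (hz : z.2 ≤ 0) : clampS z = (z.1, 0) := by
  simp only [clampS]; rw [min_eq_left (by linarith), max_eq_left hz]

lemma clampS_high {z : ℝ × ℝ} (hz : 1 ≤ z.2) : clampS z = (z.1, 1) := by
  simp only [clampS]; rw [min_eq_right hz, max_eq_right (by norm_num)]

lemma extF_mem (F : ℝ × ℝ → ℝ × ℝ) {z : ℝ × ℝ} (hz : z ∈ stripA) : extF F z = F z := by
  have := mem_stripA.1 hz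
  simp only [extF, clampS_of_mem hz]
  rw [min_eq_right this.1, max_eq_right (by linarith)]
  ext <;> simp

lemma extF_low (F : ℝ × ℝ → ℝ × ℝ) (h0 : ∀ x : ℝ, (F (x, 0)).2 = 0) {z : ℝ × ℝ}
    (hz : z.2 ≤ 0) : extF F z = ((F (z.1, 0)).1, z.2 / 4) := by
  simp only [extF, clampS_low hz, h0]
  rw [min_eq_left hz, max_eq_right (by linarith)]
  ext <;> simp

lemma extF_high (F : ℝ × ℝ → ℝ × ℝ) (h1 : ∀ x : ℝ, (F (x, 1)).2 = 1) {z : ℝ × ℝ}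
    (hz : 1 ≤ z.2) : extF F z = ((F (z.1, 1)).1, 1 + 4 * (z.2 - 1)) := by
  simp only [extF, clampS_high hz, h1]
  rw [min_eq_right (by linarith), max_eq_left (by linarith)]
  ext <;> simp

lemma extF_continuous (F : ℝ × ℝ → ℝ × ℝ) (hF : ContinuousOn F stripA) :
    Continuous (extF F) := by
  have h : Continuous (fun z => F (clampS z)) :=
    hF.comp_continuous continuous_clampS clampS_mem
  unfold extF
  exact (continuous_fst.comp h).prodMk ((continuous_snd.comp h).add (by fun_prop))

lemma extF_injective (F : ℝ × ℝ → ℝ × ℝ) (hFm : MapsTo F stripA stripA)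
    (hFi : InjOn F stripA) (h0 : ∀ x : ℝ, (F (x, 0)).2 = 0) (h1 : ∀ x : ℝ, (F (x, 1)).2 = 1) :
    Function.Injective (extF F) := by
  -- the second coordinate of the image determines the second coordinate up to the clamp
  have hsep : ∀ z : ℝ × ℝ, (z.2 < 0 ∧ (extF F z).2 < 0) ∨
      (z ∈ stripA ∧ 0 ≤ (extF F z).2 ∧ (extF F z).2 ≤ 1) ∨ (1 < z.2 ∧ 1 < (extF F z).2) := by
    intro z
    rcases lt_or_ge z.2 0 with h | h
    · left; refine ⟨h, ?_⟩; rw [extF_low F h0 h.le]; simp only; linarith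
    · rcases lt_or_ge 1 z.2 with h' | h'
      · right; right; refine ⟨h', ?_⟩; rw [extF_high F h1 h'.le]; simp only; linarith
      · right; left
        have hz : z ∈ stripA := mem_stripA.2 ⟨h, h'⟩
        refine ⟨hz, ?_⟩
        rw [extF_mem F hz]; exact mem_stripA.1 (hFm hz)
  intro p q hpq
  have e1 : (extF F p).1 = (extF F q).1 := by rw [hpq]
  have e2 : (extF F p).2 = (extF F q).2 := by rw [hpq]
  rcases hsep p with ⟨hp, hp'⟩ | ⟨hp, hp'⟩ | ⟨hp, hp'⟩ <;>
    rcases hsep q with ⟨hq, hq'⟩ | ⟨hq, hq'⟩ | ⟨hq, hq'⟩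
  · rw [extF_low F h0 hp.le, extF_low F h0 hq.le] at e1 e2
    have : F (p.1, 0) = F (q.1, 0) := Prod.ext e1 (by rw [h0, h0])
    have := hFi (mem_stripA.2 (by norm_num)) (mem_stripA.2 (by norm_num)) this
    have h3 : p.1 = q.1 := (Prod.ext_iff.1 this).1
    simp only at e2
    exact Prod.ext h3 (by linarith)
  · linarith [hq'.1]
  · linarith
  · linarith [hp'.1]
  · rw [extF_mem F hp, extF_mem F hq] at hpq
    exact hFi hp hq hpq
  · linarith [hp'.2]
  · linarith
  · linarith [hq'.2]
  · rw [extF_high F h1 hp.le, extF_high F h1 hq.le] at e1 e2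
    have : F (p.1, 1) = F (q.1, 1) := Prod.ext e1 (by rw [h1, h1])
    have := hFi (mem_stripA.2 (by norm_num)) (mem_stripA.2 (by norm_num)) this
    have h3 : p.1 = q.1 := (Prod.ext_iff.1 this).1
    simp only at e2
    exact Prod.ext h3 (by linarith)

lemma cos_sin_neg {r t x y : ℝ} (hr : 0 < r) (h1 : x = r * Real.cos t) (h2 : y = r * Real.sin t)
    (hx : x < 0) (hy : y = 0) : Real.cos t = -1 ∧ Real.sin t = 0 := by
  have hs : Real.sin t = 0 := by
    rw [hy] at h2
    rcases mul_eq_zero.1 h2.symm with h | h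
    · linarith
    · exact h
  refine ⟨?_, hs⟩
  have := Real.sin_sq_add_cos_sq t
  rw [hs] at this
  have h3 : (Real.cos t - 1) * (Real.cos t + 1) = 0 := by linarith
  rcases mul_eq_zero.1 h3 with h | h
  · have : Real.cos t = 1 := by linarith
    rw [this] at h1; linarith
  · linarith

lemma cos_sin_pos {r t x y : ℝ} (hr : 0 < r) (h1 : x = r * Real.cos t) (h2 : y = r * Real.sin t)
    (hx : 0 < x) (hy : y = 0) : Real.cos t = 1 ∧ Real.sin t = 0 := by
  have hs : Real.sin t = 0 := by
    rw [hy] at h2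
    rcases mul_eq_zero.1 h2.symm with h | h
    · linarith
    · exact h
  refine ⟨?_, hs⟩
  have := Real.sin_sq_add_cos_sq t
  rw [hs] at this
  have h3 : (Real.cos t - 1) * (Real.cos t + 1) = 0 := by linarith
  rcases mul_eq_zero.1 h3 with h | h
  · linarith
  · have : Real.cos t = -1 := by linarith
    rw [this] at h1; linarith

/-- The chain statement used below. -/
def UpChain (F : ℝ × ℝ → ℝ × ℝ) : Prop :=
  ∀ ε > 0, ∃ (n : ℕ) (z : ℕ → ℝ × ℝ), (∀ i, z i ∈ stripA) ∧ (z 0).2 = 0 ∧ (z n).2 = 1 ∧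
    ∀ i < n, dist (F (z i)) (z (i + 1)) < ε

lemma rotation_of_chain (F G : ℝ × ℝ → ℝ × ℝ) (hFc : ContinuousOn F stripA)
    (hGc : ContinuousOn G stripA) (hFm : MapsTo F stripA stripA) (hGm : MapsTo G stripA stripA)
    (hGF : ∀ p ∈ stripA, G (F p) = p) (hFG : ∀ p ∈ stripA, F (G p) = p)
    (h0 : ∀ x : ℝ, (F (x, 0)).2 = 0) (h1 : ∀ x : ℝ, (F (x, 1)).2 = 1)
    (δ : ℝ) (hδ : 0 < δ) (ht0 : ∀ x : ℝ, (F (x, 0)).1 ≤ x - δ)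
    (ht1 : ∀ x : ℝ, x + δ ≤ (F (x, 1)).1) (hdist : ∀ z ∈ stripA, δ ≤ dist (F z) z)
    (hch : UpChain F) (θ : ℝ × ℝ → ℝ) (hθc : Continuous θ)
    (hθ : ∀ z ∈ stripA, ∃ r : ℝ, 0 < r ∧ (F z).1 - z.1 = r * Real.cos (θ z) ∧
      (F z).2 - z.2 = r * Real.sin (θ z)) :
    ∃ x x' : ℝ, θ (x', 1) = θ (x, 0) - Real.pi := by
  have hFi : InjOn F stripA := fun p hp q hq h => by rw [← hGF p hp, h, hGF q hq]
  have hs0 : ∀ x : ℝ, (x, (0 : ℝ)) ∈ stripA := fun x => mem_stripA.2 (by norm_num)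
  have hs1 : ∀ x : ℝ, (x, (1 : ℝ)) ∈ stripA := fun x => mem_stripA.2 (by norm_num)
  have hc0 : ∀ x : ℝ, Real.cos (θ (x, 0)) = -1 ∧ Real.sin (θ (x, 0)) = 0 := by
    intro x
    obtain ⟨r, hr, e1, e2⟩ := hθ _ (hs0 x)
    exact cos_sin_neg hr e1 e2 (by simp only; linarith [ht0 x]) (by simp [h0])
  have hc1 : ∀ x : ℝ, Real.cos (θ (x, 1)) = 1 ∧ Real.sin (θ (x, 1)) = 0 := by
    intro x
    obtain ⟨r, hr, e1, e2⟩ := hθ _ (hs1 x)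
    exact cos_sin_pos hr e1 e2 (by simp only; linarith [ht1 x]) (by simp [h1])
  set ε := min (δ / 4) 1 with hεdef
  have hε : 0 < ε := lt_min (by linarith) (by norm_num)
  have hεδ : ε ≤ δ / 4 := min_le_left _ _
  have hε1 : ε ≤ 1 := min_le_right _ _
  obtain ⟨n, z, hz, hz0, hzn, hzc⟩ := hch (ε / 4) (by linarith)
  -- generic perturbation
  have hηex : ∀ i, ∃ η > 0, ∀ p ∈ stripA, dist p (z i) < η →
      dist p (z i) < ε / 4 ∧ dist (F p) (F (z i)) < ε / 4 := by
    intro i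
    obtain ⟨η, hη, h⟩ := Metric.continuousOn_iff.1 hFc (z i) (hz i) (ε / 4) (by linarith)
    exact ⟨min η (ε / 4), lt_min hη (by linarith), fun p hp hd =>
      ⟨hd.trans_le (min_le_right _ _), h p hp (hd.trans_le (min_le_left _ _))⟩⟩
  choose η hη hηp using hηex
  obtain ⟨z', hz'1, hz'x, hz'y⟩ := generic_seq F G hFm hGm hGc hGF hFG z hz η hη (n + 1)
  have hcoord : ∀ (p q : ℝ × ℝ) (c : ℝ), dist p q < c → |p.1 - q.1| < c ∧ |p.2 - q.2| < c := by
    intro p q c h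
    rw [Prod.dist_eq, max_lt_iff, Real.dist_eq, Real.dist_eq] at h
    exact h
  have hn2 : 2 ≤ n := by
    by_contra! h
    interval_cases n
    · linarith
    · have h2 := (hcoord _ _ _ (hzc 0 (by norm_num))).2
      have e : z 0 = ((z 0).1, 0) := Prod.ext rfl hz0
      rw [e, h0, zero_add, hzn] at h2
      norm_num at h2
      linarith
  set w : ℕ → ℝ × ℝ := fun i => if i = 0 then ((z 0).1, -2 * ε) else
    if i = n then ((z' n).1, 1 + ε / 2) else z' i with hwdef
  have hw0 : w 0 = ((z 0).1, -2 * ε) := by simp [hwdef]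
  have hwn : w n = ((z' n).1, 1 + ε / 2) := by
    simp only [hwdef]; rw [if_neg (by omega)]; simp
  have hwi : ∀ i, 0 < i → i < n → w i = z' i := by
    intro i hi hin
    simp only [hwdef]; rw [if_neg (by omega), if_neg (by omega)]
  have hwx : ∀ i, 0 < i → i ≤ n → (w i).1 = (z' i).1 := by
    intro i hi hin
    rcases hin.lt_or_eq with h | h
    · rw [hwi i hi h]
    · rw [h, hwn]
  set Fe := extF F with hFe
  have hFew0 : Fe (w 0) = ((F (z 0)).1, -ε / 2) := by
    rw [hFe, extF_low F h0 (by rw [hw0]; simp only; linarith), hw0]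
    have e : z 0 = ((z 0).1, 0) := Prod.ext rfl hz0
    simp only
    rw [← e]
    congr 1
    ring
  have hFewi : ∀ i, 0 < i → i < n → Fe (w i) = F (z' i) := by
    intro i hi hin
    rw [hwi i hi hin, hFe, extF_mem F (hz'1 i (by omega)).1]
  have hjump : ∀ i < n, |(w (i + 1)).1 - (Fe (w i)).1| ≤ ε ∧ |(w (i + 1)).2 - (Fe (w i)).2| ≤ ε := by
    intro i hi
    have a1 := hcoord _ _ _ (hzc i hi)
    obtain ⟨b1, b2⟩ := hηp (i + 1) _ (hz'1 (i + 1) (by omega)).1 (hz'1 (i + 1) (by omega)).2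
    have b1 := hcoord _ _ _ b1
    simp only [abs_lt] at a1 b1
    rw [hwx (i + 1) (by omega) (by omega)]
    rcases Nat.eq_zero_or_pos i with h | h
    · subst h
      rw [hFew0, hwi (0 + 1) (by omega) (by omega)]
      have e : (F (z 0)).2 = 0 := by
        have e : z 0 = ((z 0).1, 0) := Prod.ext rfl hz0
        rw [e, h0]
      simp only [abs_le]
      refine ⟨⟨?_, ?_⟩, ⟨?_, ?_⟩⟩ <;> linarith [a1.1.1, a1.1.2, a1.2.1, a1.2.2, b1.1.1, b1.1.2, b1.2.1, b1.2.2]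
    · rw [hFewi i h hi]
      obtain ⟨-, c2⟩ := hηp i _ (hz'1 i (by omega)).1 (hz'1 i (by omega)).2
      have c2 := hcoord _ _ _ c2
      simp only [abs_lt] at c2
      simp only [abs_le]
      rcases Nat.lt_or_ge (i + 1) n with h' | h'
      · rw [hwi (i + 1) (by omega) h']
        refine ⟨⟨?_, ?_⟩, ⟨?_, ?_⟩⟩ <;> linarith [a1.1.1, a1.1.2, a1.2.1, a1.2.2, b1.1.1, b1.1.2, b1.2.1, b1.2.2, c2.1.1, c2.1.2, c2.2.1, c2.2.2]
      · have e : i + 1 = n := by omega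
        rw [e] at a1 b1 ⊢
        rw [hwn]
        simp only
        refine ⟨⟨?_, ?_⟩, ⟨?_, ?_⟩⟩ <;> linarith [a1.1.1, a1.1.2, a1.2.1, a1.2.2, b1.1.1, b1.1.2, b1.2.1, b1.2.2, c2.1.1, c2.1.2, c2.2.1, c2.2.2]
  obtain ⟨a, hac, hab, hai⟩ := interp n (fun i => (Fe (w i)).2)
    (fun i => (w (i + 1)).1 - (Fe (w i)).1) ε hε.le (by
      intro i hi j hj
      rcases Nat.eq_zero_or_pos i with h | h <;> rcases Nat.eq_zero_or_pos j with h' | h'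
      · intro _; omega
      · subst h
        rw [hFew0, hFewi j h' hj]
        intro e
        have := (mem_stripA.1 (hFm (hz'1 j (by omega)).1)).1
        simp only at e
        linarith
      · subst h'
        rw [hFew0, hFewi i h hi]
        intro e
        have := (mem_stripA.1 (hFm (hz'1 i (by omega)).1)).1
        simp only at e
        linarith
      · rw [hFewi i h hi, hFewi j h' hj]
        exact hz'y i (by omega) j (by omega)) (fun i hi => (hjump i hi).1)
  obtain ⟨b, hbc, hbb, hbi⟩ := interp n (fun i => (w (i + 1)).1)
    (fun i => (w (i + 1)).2 - (Fe (w i)).2) ε hε.le (by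
      intro i hi j hj
      rw [hwx (i + 1) (by omega) (by omega), hwx (j + 1) (by omega) (by omega)]
      intro e
      have := hz'x (i + 1) (by omega) (j + 1) (by omega) e
      omega) (fun i hi => (hjump i hi).2)
  have hFec : Continuous Fe := extF_continuous F hFc
  have hFei : Function.Injective Fe := extF_injective F hFm hFi h0 h1
  set X : ℝ × ℝ → ℝ := fun p => (Fe p).1 + a (Fe p).2 with hX
  set Gp : ℝ × ℝ → ℝ × ℝ := fun p => (X p, (Fe p).2 + b (X p)) with hGp
  have hGpc : Continuous Gp := by fun_prop
  have hGpi : Function.Injective Gp := by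
    intro p q h
    have e1 : X p = X q := (Prod.ext_iff.1 h).1
    have e2 : (Fe p).2 + b (X p) = (Fe q).2 + b (X q) := (Prod.ext_iff.1 h).2
    rw [e1] at e2
    have e3 : (Fe p).2 = (Fe q).2 := by linarith
    simp only [hX] at e1
    rw [e3] at e1
    exact hFei (Prod.ext (by linarith) e3)
  have hGpw : ∀ i < n, Gp (w i) = w (i + 1) := by
    intro i hi
    have e1 : X (w i) = (w (i + 1)).1 := by
      simp only [hX]; rw [hai i hi]; ring
    simp only [hGp]
    rw [e1, hbi i hi]
    ext
    · rfl
    · simp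
  have hiter : ∀ i ≤ n, Gp^[i] (w 0) = w i := by
    intro i hi
    induction i with
    | zero => rfl
    | succ i ih => rw [Function.iterate_succ_apply', ih (by omega), hGpw i (by omega)]
  have hab' := fun x => abs_le.1 (hab x)
  have hbb' := fun x => abs_le.1 (hbb x)
  have hgrow : ∀ p : ℝ × ℝ, 1 ≤ p.2 → 1 + 4 * (p.2 - 1) - ε ≤ (Gp p).2 := by
    intro p hp
    have e : (Fe p).2 = 1 + 4 * (p.2 - 1) := by rw [hFe, extF_high F h1 hp]
    simp only [hGp]
    rw [e]
    linarith [(hbb' (X p)).1]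
  have hFelow : ∀ p : ℝ × ℝ, -2 * ε ≤ p.2 → -ε / 2 ≤ (Fe p).2 := by
    intro p hp
    rcases le_or_gt p.2 0 with h | h
    · rw [hFe, extF_low F h0 h]; simp only; linarith
    · rcases le_or_gt p.2 1 with h' | h'
      · have hm : p ∈ stripA := mem_stripA.2 ⟨h.le, h'⟩
        rw [hFe, extF_mem F hm]
        linarith [(mem_stripA.1 (hFm hm)).1]
      · rw [hFe, extF_high F h1 h'.le]; simp only; linarith
  have hFehigh : ∀ p : ℝ × ℝ, p.2 < 1 → (Fe p).2 ≤ 1 := by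
    intro p hp
    rcases le_or_gt p.2 0 with h | h
    · rw [hFe, extF_low F h0 h]; simp only; linarith
    · have hm : p ∈ stripA := mem_stripA.2 ⟨h.le, hp.le⟩
      rw [hFe, extF_mem F hm]
      exact (mem_stripA.1 (hFm hm)).2
  obtain ⟨p, hp1, hp2⟩ := core_rotation Gp hGpc hGpi ε hε b hbb (w 0) (by rw [hw0])
    (by
      intro p hp
      simp only [hGp]
      linarith [hFelow p hp])
    (by simp only [hGp]; rw [hFew0])
    (fun p => θ (clampS p)) (hθc.comp continuous_clampS)
    (by
      intro p
      have g1 : (Gp p).1 = (Fe p).1 + a (Fe p).2 := rfl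
      have g2 : (Gp p).2 = (Fe p).2 + b (X p) := rfl
      have ha := hab' (Fe p).2
      have hb := hbb' (X p)
      rw [g1, g2]
      generalize a (Fe p).2 = A at *
      generalize b (X p) = B at *
      rcases le_or_gt p.2 0 with h | h
      · rw [clampS_low h, (hc0 p.1).1, (hc0 p.1).2, hFe, extF_low F h0 h]
        have := ht0 p.1
        simp only
        linarith
      · rcases le_or_gt 1 p.2 with h' | h'
        · rw [clampS_high h', (hc1 p.1).1, (hc1 p.1).2, hFe, extF_high F h1 h']
          have := ht1 p.1
          simp only
          linarith
        · have hm : p ∈ stripA := mem_stripA.2 ⟨h.le, h'.le⟩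
          rw [clampS_of_mem hm, hFe, extF_mem F hm]
          obtain ⟨r, hr, e1, e2⟩ := hθ p hm
          have hd := hdist p hm
          rw [Prod.dist_eq, Real.dist_eq, Real.dist_eq, e1, e2, abs_mul, abs_mul,
            abs_of_pos hr] at hd
          have hc := Real.abs_cos_le_one (θ p)
          have hs := Real.abs_sin_le_one (θ p)
          have hrδ : δ ≤ r := hd.trans (max_le (by nlinarith) (by nlinarith))
          have i1 : |Real.cos (θ p) * A| ≤ 1 * ε := by
            rw [abs_mul]; exact mul_le_mul hc (abs_le.2 ha) (abs_nonneg _) (by norm_num)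
          have i2 : |Real.sin (θ p) * B| ≤ 1 * ε := by
            rw [abs_mul]; exact mul_le_mul hs (abs_le.2 hb) (abs_nonneg _) (by norm_num)
          have i1 := (abs_le.1 i1).1
          have i2 := (abs_le.1 i2).1
          have key : Real.cos (θ p) * ((F p).1 + A - p.1) + Real.sin (θ p) * ((F p).2 + B - p.2)
              = r + Real.cos (θ p) * A + Real.sin (θ p) * B := by
            have e1' : (F p).1 + A - p.1 = r * Real.cos (θ p) + A := by linarith
            have e2' : (F p).2 + B - p.2 = r * Real.sin (θ p) + B := by linarith
            rw [e1', e2']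
            linear_combination r * Real.sin_sq_add_cos_sq (θ p)
          rw [key]
          linarith)
    (by
      intro p hp
      simp only [hGp]
      linarith [hFehigh p hp, (hbb' (X p)).2])
    (n + 2)
    (by
      rw [Nat.add_comm, Function.iterate_add_apply, hiter n le_rfl]
      have g1 := hgrow (w n) (by rw [hwn]; simp only; linarith)
      rw [hwn] at g1
      simp only at g1
      have g2 := hgrow (Gp (w n)) (by rw [hwn]; linarith)
      rw [hwn] at g2
      rw [hwn]
      simp only [Function.iterate_succ, Function.iterate_zero, Function.comp_apply, id]
      linarith)
    (by
      rw [hw0, clampS_low (by simp only; linarith)]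
      exact (hc0 _).1)
    (by
      intro p hp
      rw [clampS_high hp]
      exact (hc1 _).1)
  rw [clampS_high hp1, hw0, clampS_low (by simp only; linarith)] at hp2
  exact ⟨_, _, hp2⟩


/-- integer translation in the strip -/
def shiftZ (n : ℤ) (z : ℝ × ℝ) : ℝ × ℝ := (z.1 + n, z.2)

lemma shiftZ_mem {n : ℤ} {z : ℝ × ℝ} (hz : z ∈ stripA) : shiftZ n z ∈ stripA :=
  mem_stripA.2 (mem_stripA.1 hz)

lemma shiftZ_neg (n : ℤ) (z : ℝ × ℝ) : shiftZ n (shiftZ (-n) z) = z := by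
  ext <;> simp [shiftZ]

lemma continuous_shiftZ (n : ℤ) : Continuous (shiftZ n) := by
  unfold shiftZ; fun_prop

lemma dist_shiftZ (n : ℤ) (z w : ℝ × ℝ) : dist (shiftZ n z) (shiftZ n w) = dist z w := by
  simp [shiftZ, Prod.dist_eq]

lemma F_shiftZ (F : ℝ × ℝ → ℝ × ℝ)
    (hper : ∀ p ∈ stripA, F (p.1 + 1, p.2) = ((F p).1 + 1, (F p).2)) (n : ℤ) :
    ∀ z ∈ stripA, F (shiftZ n z) = shiftZ n (F z) := by
  induction n using Int.induction_on with
  | zero => intro z _; simp [shiftZ]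
  | succ k ih =>
    intro z hz
    have h := hper _ (shiftZ_mem (n := k) hz)
    rw [ih z hz] at h
    have e : ((shiftZ k z).1 + 1, (shiftZ k z).2) = shiftZ (k + 1) z := by
      simp [shiftZ, add_assoc]
    rw [e] at h
    rw [h]
    simp [shiftZ, add_assoc]
  | pred k ih =>
    intro z hz
    have h := hper _ (shiftZ_mem (n := -k - 1) hz)
    have e : ((shiftZ (-k - 1) z).1 + 1, (shiftZ (-k - 1) z).2) = shiftZ (-k) z := by
      simp [shiftZ]; ring
    rw [e, ih z hz] at h
    have h1 := congrArg Prod.fst h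
    have h2 := congrArg Prod.snd h
    simp only [shiftZ] at h1 h2 ⊢
    push_cast at h1 h2 ⊢
    ext
    · simp only; linarith
    · simp only; exact h2.symm

lemma covProj_eq {p q : ℝ × ℝ} (h : covProj p = covProj q) : ∃ n : ℤ, q = shiftZ n p := by
  have h1 := congrArg Prod.fst h
  have h2 := congrArg Prod.snd h
  simp only [covProj] at h1 h2
  rw [QuotientAddGroup.eq, AddSubgroup.mem_zmultiples_iff] at h1
  obtain ⟨k, hk⟩ := h1
  refine ⟨k, ?_⟩
  ext
  · simp only [shiftZ]
    simp at hk
    linarith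
  · exact h2.symm

lemma covProj_continuous : Continuous covProj := by
  unfold covProj
  exact ((AddCircle.continuous_mk' 1).comp continuous_fst).prodMk continuous_snd

lemma covProj_isOpenMap : IsOpenMap covProj := by
  have : IsOpenMap (fun x : ℝ => (x : AddCircle (1 : ℝ))) := QuotientAddGroup.isOpenMap_coe
  exact this.prodMap IsOpenMap.id

lemma covProj_surj : Function.Surjective covProj := by
  rintro ⟨a, y⟩
  obtain ⟨x, hx⟩ := QuotientAddGroup.mk_surjective a
  exact ⟨(x, y), Prod.ext hx rfl⟩

lemma covProj_image_closed {S : Set (ℝ × ℝ)} (hS : IsClosed S)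
    (hp : ∀ (n : ℤ), ∀ z ∈ S, shiftZ n z ∈ S) : IsClosed (covProj '' S) := by
  have : covProj '' S = (covProj '' Sᶜ)ᶜ := by
    ext a
    constructor
    · rintro ⟨z, hz, rfl⟩ ⟨w, hw, e⟩
      obtain ⟨n, rfl⟩ := covProj_eq e.symm
      exact hw (hp n z hz)
    · intro h
      obtain ⟨z, rfl⟩ := covProj_surj a
      by_contra h'
      exact h ⟨z, fun hz => h' ⟨z, hz, rfl⟩, rfl⟩
  rw [this]
  exact (covProj_isOpenMap _ hS.isOpen_compl).isClosed_compl

lemma covProj_mem {p : ℝ × ℝ} (hp : p ∈ stripA) : covProj p ∈ annA :=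
  ⟨mem_univ _, hp.2⟩

/-- one step of an `ε`-chain -/
def chainStep (F : ℝ × ℝ → ℝ × ℝ) (ε : ℝ) (z z' : ℝ × ℝ) : Prop :=
  z ∈ stripA ∧ z' ∈ stripA ∧ dist (F z) z' < ε

lemma chainStep_shift (F : ℝ × ℝ → ℝ × ℝ)
    (hper : ∀ p ∈ stripA, F (p.1 + 1, p.2) = ((F p).1 + 1, (F p).2)) (ε : ℝ) (n : ℤ)
    (z z' : ℝ × ℝ) (h : chainStep F ε z z') : chainStep F ε (shiftZ n z) (shiftZ n z') := by
  refine ⟨shiftZ_mem h.1, shiftZ_mem h.2.1, ?_⟩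
  rw [F_shiftZ F hper n z h.1, dist_shiftZ]
  exact h.2.2

lemma open_null_empty (μ : Measure Cyl) (d : Cyl → ℝ) (hd_meas : Measurable d)
    (hd_pos : ∀ᵐ a ∂(volume.restrict annA), 0 < d a)
    (hdens : ∀ U : Set Cyl, U ⊆ annA → MeasurableSet U →
      μ U = ∫⁻ a in U, ENNReal.ofReal (d a) ∂volume)
    (O : Set Cyl) (hO : IsOpen O) (hOA : O ⊆ annA) (hne : O.Nonempty) : μ O ≠ 0 := by
  intro h0
  haveI : Fact ((0 : ℝ) < 1) := ⟨one_pos⟩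
  rw [hdens O hOA hO.measurableSet, lintegral_eq_zero_iff (by fun_prop)] at h0
  have h1 : ∀ᵐ a ∂(volume.restrict O), 0 < d a :=
    ae_mono (Measure.restrict_mono hOA le_rfl) hd_pos
  have h2 : ∀ᵐ a ∂(volume.restrict O), False := by
    filter_upwards [h0, h1] with a ha hb
    simp only [Pi.zero_apply, ENNReal.ofReal_eq_zero] at ha
    linarith
  rw [Filter.eventually_false_iff_eq_bot, ae_eq_bot, Measure.restrict_eq_zero] at h2
  exact (hO.measure_pos volume hne).ne' h2

lemma reach_all (f : Cyl → Cyl) (F G : ℝ × ℝ → ℝ × ℝ)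
    (hlift : ∀ p ∈ stripA, covProj (F p) = f (covProj p))
    (hper : ∀ p ∈ stripA, F (p.1 + 1, p.2) = ((F p).1 + 1, (F p).2))
    (hFc : ContinuousOn F stripA) (hGc : ContinuousOn G stripA)
    (hFm : MapsTo F stripA stripA) (hGm : MapsTo G stripA stripA)
    (hGF : ∀ p ∈ stripA, G (F p) = p) (hFG : ∀ p ∈ stripA, F (G p) = p)
    (μ : Measure Cyl) [IsFiniteMeasure μ]
    (d : Cyl → ℝ) (hd_meas : Measurable d)
    (hd_pos : ∀ᵐ a ∂(volume.restrict annA), 0 < d a)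
    (hdens : ∀ U : Set Cyl, U ⊆ annA → MeasurableSet U →
      μ U = ∫⁻ a in U, ENNReal.ofReal (d a) ∂volume)
    (hinv : ∀ U : Set Cyl, U ⊆ annA → MeasurableSet U → μ (f '' U) = μ U)
    (ε : ℝ) (hε : 0 < ε) (B : Set (ℝ × ℝ)) (hB : B ⊆ stripA) (hBne : B.Nonempty)
    (hBs : ∀ (n : ℤ), ∀ z ∈ B, shiftZ n z ∈ B) (z : ℝ × ℝ) (hz : z ∈ stripA) :
    ∃ b ∈ B, Relation.ReflTransGen (chainStep F ε) b z := by
  set W : Set (ℝ × ℝ) := {z | ∃ b ∈ B, Relation.ReflTransGen (chainStep F ε) b z} with hW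
  have hclosed : IsClosed stripA := isClosed_univ.prod isClosed_Icc
  have hWs : W ⊆ stripA := by
    rintro w ⟨b, hb, h⟩
    rcases Relation.ReflTransGen.cases_tail h with rfl | ⟨c, _, hc⟩
    · exact hB hb
    · exact hc.2.1
  have hWsh : ∀ (n : ℤ), ∀ w ∈ W, shiftZ n w ∈ W := by
    rintro n w ⟨b, hb, h⟩
    exact ⟨shiftZ n b, hBs n b hb, h.lift (shiftZ n) (chainStep_shift F hper ε n)⟩
  set U : Set (ℝ × ℝ) := {z' | ∃ w ∈ W, dist (F w) z' < ε} with hU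
  have hUo : IsOpen U := by
    have : U = ⋃ w ∈ W, Metric.ball (F w) ε := by
      ext z'; simp [hU, dist_comm]
    rw [this]
    exact isOpen_biUnion fun _ _ => Metric.isOpen_ball
  have hUW : ∀ z' ∈ stripA, z' ∈ U → z' ∈ W := by
    rintro z' hz' ⟨w, ⟨b, hb, h⟩, hd⟩
    exact ⟨b, hb, h.tail ⟨hWs ⟨b, hb, h⟩, hz', hd⟩⟩
  set K := closure W with hK
  have hKs : K ⊆ stripA := closure_minimal hWs hclosed
  have hKsh : ∀ (n : ℤ), ∀ w ∈ K, shiftZ n w ∈ K := fun n w hw =>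
    map_mem_closure (continuous_shiftZ n) hw (hWsh n)
  have hFKU : ∀ k ∈ K, F k ∈ U := by
    intro k hk
    obtain ⟨η, hη, h⟩ := Metric.continuousOn_iff.1 hFc k (hKs hk) ε hε
    obtain ⟨w, hw, hd⟩ := Metric.mem_closure_iff.1 hk η hη
    exact ⟨w, hw, h w (hWs hw) (by rwa [dist_comm])⟩
  have hFKeq : F '' K = stripA ∩ G ⁻¹' K := by
    ext p
    constructor
    · rintro ⟨k, hk, rfl⟩
      refine ⟨hFm (hKs hk), ?_⟩
      simp only [mem_preimage]
      rwa [hGF k (hKs hk)]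
    · rintro ⟨hp, hg⟩
      exact ⟨G p, hg, hFG p hp⟩
  have hFKc : IsClosed (F '' K) := by
    rw [hFKeq]
    exact hGc.preimage_isClosed_of_isClosed hclosed isClosed_closure
  have hFKsh : ∀ (n : ℤ), ∀ w ∈ F '' K, shiftZ n w ∈ F '' K := by
    rintro n _ ⟨k, hk, rfl⟩
    exact ⟨shiftZ n k, hKsh n k hk, F_shiftZ F hper n k (hKs hk)⟩
  have hFKK : F '' K ⊆ K := by
    rintro _ ⟨k, hk, rfl⟩
    exact subset_closure (hUW _ (hFm (hKs hk)) (hFKU k hk))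
  have hpK : IsClosed (covProj '' K) := covProj_image_closed isClosed_closure hKsh
  have hpFK : IsClosed (covProj '' (F '' K)) := covProj_image_closed hFKc hFKsh
  have hpKA : covProj '' K ⊆ annA := by
    rintro _ ⟨k, hk, rfl⟩; exact covProj_mem (hKs hk)
  have himg : f '' (covProj '' K) = covProj '' (F '' K) := by
    rw [image_image, image_image]
    exact image_congr fun k hk => (hlift k (hKs hk)).symm
  have hnull : μ (covProj '' K \ covProj '' (F '' K)) = 0 := by
    rw [measure_sdiff (image_mono hFKK) hpFK.measurableSet.nullMeasurableSet
      (measure_ne_top _ _), ← himg, hinv _ hpKA hpK.measurableSet, tsub_self]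
  -- the two sets coincide
  have hUFK : ∀ z' ∈ stripA, z' ∈ U → z' ∈ F '' K := by
    intro z' hz' hzU
    by_contra hn
    set O := (U ∩ (F '' K)ᶜ) ∩ (univ ×ˢ Ioo (0 : ℝ) 1) with hO
    have hOo : IsOpen O := (hUo.inter hFKc.isOpen_compl).inter (isOpen_univ.prod isOpen_Ioo)
    have hOs : O ⊆ stripA := fun p hp => ⟨mem_univ _, Ioo_subset_Icc_self hp.2.2⟩
    have hOne : O.Nonempty := by
      have hcl : z' ∈ closure ((univ : Set ℝ) ×ˢ Ioo (0 : ℝ) 1) := by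
        rw [closure_prod_eq, closure_univ, closure_Ioo (by norm_num)]
        exact hz'
      exact mem_closure_iff.1 hcl _ (hUo.inter hFKc.isOpen_compl) ⟨hzU, hn⟩
    refine open_null_empty μ d hd_meas hd_pos hdens (covProj '' O) (covProj_isOpenMap _ hOo)
      ?_ (hOne.image _) (measure_mono_null ?_ hnull)
    · rintro _ ⟨k, hk, rfl⟩; exact covProj_mem (hOs hk)
    · rintro _ ⟨o, ho, rfl⟩
      refine ⟨⟨o, subset_closure (hUW o (hOs ho) ho.1.1), rfl⟩, ?_⟩
      rintro ⟨k, hk, e⟩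
      obtain ⟨n, hn⟩ := covProj_eq e
      exact ho.1.2 (hn ▸ hFKsh n k hk)
  have hpre : IsPreconnected stripA :=
    (convex_univ.prod (convex_Icc (0 : ℝ) 1)).isPreconnected
  by_contra hzW
  obtain ⟨b, hb⟩ := hBne
  have hbW : b ∈ W := ⟨b, hb, Relation.ReflTransGen.refl⟩
  obtain ⟨p, hp, hpU, hpn⟩ := hpre U (F '' K)ᶜ hUo hFKc.isOpen_compl
    (fun p hp => by
      by_cases h : p ∈ F '' K
      · obtain ⟨k, hk, rfl⟩ := h
        exact Or.inl (hFKU k hk)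
      · exact Or.inr h)
    ⟨F b, hFm (hB hb), hFKU b (subset_closure hbW)⟩
    ⟨z, hz, fun h => by
      obtain ⟨k, hk, rfl⟩ := h
      exact hzW (hUW _ hz (hFKU k hk))⟩
  exact hpn (hUFK p hp hpU)

/-- a chain in sequence form -/
lemma chain_seq (F : ℝ × ℝ → ℝ × ℝ) (ε : ℝ) (b z : ℝ × ℝ) (hb : b ∈ stripA)
    (h : Relation.ReflTransGen (chainStep F ε) b z) :
    ∃ (n : ℕ) (s : ℕ → ℝ × ℝ), (∀ i, s i ∈ stripA) ∧ s 0 = b ∧ s n = z ∧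
      ∀ i < n, dist (F (s i)) (s (i + 1)) < ε := by
  induction h with
  | refl => exact ⟨0, fun _ => b, fun _ => hb, rfl, rfl, fun i hi => absurd hi (by omega)⟩
  | @tail c e _ hce ih =>
    obtain ⟨n, s, h1, h2, h3, h4⟩ := ih
    refine ⟨n + 1, fun i => if i ≤ n then s i else e, ?_, ?_, ?_, ?_⟩
    · intro i
      by_cases hi : i ≤ n
      · simp [hi, h1]
      · simp [hi, hce.2.1]
    · simp [h2]
    · simp
    · intro i hi
      rcases Nat.lt_or_ge i n with h | h
      · have a : i ≤ n := h.le
        have b : i + 1 ≤ n := h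
        simp only [a, b, if_true]
        exact h4 i h
      · have : i = n := by omega
        subst this
        simp [h3, hce.2.2]

lemma const_of_sin_zero (u : ℝ → ℝ) (hu : Continuous u) (hs : ∀ x, Real.sin (u x) = 0)
    (a b : ℝ) : u a = u b := by
  have key : ∀ a b : ℝ, ¬ u a < u b := by
    intro a b hab
    set s := min (u b - u a) Real.pi / 2 with hsdef
    have h1 : 0 < min (u b - u a) Real.pi := lt_min (by linarith) Real.pi_pos
    have h2 := min_le_left (u b - u a) Real.pi
    have h3 := min_le_right (u b - u a) Real.pi
    obtain ⟨x, hx⟩ := mem_range_of_exists_le_of_exists_ge (c := u a + s) hu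
      ⟨a, by linarith⟩ ⟨b, by linarith⟩
    have h4 := hs x
    rw [hx, Real.sin_add, hs a] at h4
    have h5 : 0 < Real.sin s := Real.sin_pos_of_pos_of_lt_pi (by linarith) (by linarith)
    have h6 := Real.sin_sq_add_cos_sq (u a)
    rw [hs a] at h6
    have h7 : Real.cos (u a) = 0 := by
      rcases mul_eq_zero.1 (show Real.cos (u a) * Real.sin s = 0 by linarith) with h | h
      · exact h
      · exact absurd h h5.ne'
    rw [h7] at h6
    norm_num at h6
  exact le_antisymm (not_lt.1 (key b a)) (not_lt.1 (key a b))

lemma exists_delta (F : ℝ × ℝ → ℝ × ℝ)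
    (hper : ∀ p ∈ stripA, F (p.1 + 1, p.2) = ((F p).1 + 1, (F p).2))
    (hFc : ContinuousOn F stripA) (hne : ∀ p ∈ stripA, F p ≠ p) :
    ∃ δ : ℝ, 0 < δ ∧ ∀ z ∈ stripA, δ ≤ dist (F z) z := by
  have hsub : (Icc (0 : ℝ) 1 ×ˢ Icc (0 : ℝ) 1) ⊆ stripA := fun p hp => ⟨mem_univ _, hp.2⟩
  have hc : ContinuousOn (fun z => dist (F z) z) (Icc (0 : ℝ) 1 ×ˢ Icc (0 : ℝ) 1) :=
    continuous_dist.comp_continuousOn ((hFc.mono hsub).prodMk continuousOn_id)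
  obtain ⟨m, hm, hmin⟩ := (isCompact_Icc.prod isCompact_Icc).exists_isMinOn
    ⟨((0 : ℝ), (0 : ℝ)), by simp⟩ hc
  refine ⟨dist (F m) m, dist_pos.2 (hne m (hsub hm)), ?_⟩
  intro z hz
  have hz' := shiftZ_mem (n := -⌊z.1⌋) hz
  have : shiftZ (-⌊z.1⌋) z ∈ Icc (0 : ℝ) 1 ×ˢ Icc (0 : ℝ) 1 := by
    refine ⟨?_, hz.2⟩
    simp only [shiftZ]
    push_cast
    constructor
    · linarith [Int.floor_le z.1]
    · linarith [Int.lt_floor_add_one z.1]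
  have h := hmin this
  simp only [mem_ofPred_eq] at h
  rwa [F_shiftZ F hper _ z hz, dist_shiftZ] at h

/-- the rotation by a half turn of the strip -/
def halfTurn (z : ℝ × ℝ) : ℝ × ℝ := (-z.1, 1 - z.2)

lemma halfTurn_mem {z : ℝ × ℝ} (hz : z ∈ stripA) : halfTurn z ∈ stripA := by
  have := mem_stripA.1 hz
  exact mem_stripA.2 ⟨by simp only [halfTurn]; linarith, by simp only [halfTurn]; linarith⟩

lemma halfTurn_halfTurn (z : ℝ × ℝ) : halfTurn (halfTurn z) = z := by
  ext <;> simp [halfTurn]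

lemma continuous_halfTurn : Continuous halfTurn := by unfold halfTurn; fun_prop

lemma dist_halfTurn (z w : ℝ × ℝ) : dist (halfTurn z) (halfTurn w) = dist z w := by
  simp only [halfTurn, Prod.dist_eq, dist_neg_neg, dist_sub_left]

lemma dist_halfTurn' (z w : ℝ × ℝ) : dist (halfTurn z) w = dist z (halfTurn w) := by
  rw [← dist_halfTurn, halfTurn_halfTurn]

/-- If `f : A → A` is a C¹ diffeomorphism of the standard annulus mapping each boundary
component to itself, is a twist map, and admits a positive integral invariant, then `f` has
at least one fixed point. -/
theorem exists_fixed_point_of_twist_map_with_positive_integral_invariant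
    (f : Cyl → Cyl) (F G : ℝ × ℝ → ℝ × ℝ)
    -- `F` is a lift of `f`: `π ∘ f̃ = f ∘ π`
    (hlift : ∀ p ∈ stripA, covProj (F p) = f (covProj p))
    -- equivariance of the lift: `f̃(x+1, y) = f̃(x, y) + (1, 0)`
    (hper : ∀ p ∈ stripA, F (p.1 + 1, p.2) = ((F p).1 + 1, (F p).2))
    -- `f` is a C¹ diffeomorphism (through its lift): C¹, bijective on the strip,
    -- with a C¹ inverse lift `G`
    (hFC1 : ContDiffOn ℝ 1 F stripA)
    (hFbij : Set.BijOn F stripA stripA)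
    (hGC1 : ContDiffOn ℝ 1 G stripA)
    (hGmaps : Set.MapsTo G stripA stripA)
    (hGF : ∀ p ∈ stripA, G (F p) = p)
    (hFG : ∀ p ∈ stripA, F (G p) = p)
    -- each boundary component is mapped to itself
    (hbdry0 : ∀ x : ℝ, (F (x, 0)).2 = 0)
    (hbdry1 : ∀ x : ℝ, (F (x, 1)).2 = 1)
    -- twist condition for the normalized lift
    (htwist0 : ∀ x : ℝ, (F (x, 0)).1 < x)
    (htwist1 : ∀ x : ℝ, x < (F (x, 1)).1)
    -- `f` admits a positive integral invariant: a finite measure `μ` with density `d`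
    -- positive almost everywhere w.r.t. Lebesgue measure, invariant under `f`
    (μ : Measure Cyl) [IsFiniteMeasure μ]
    (d : Cyl → ℝ) (hd_meas : Measurable d)
    (hd_pos : ∀ᵐ a ∂(volume.restrict annA), 0 < d a)
    (hdens : ∀ U : Set Cyl, U ⊆ annA → MeasurableSet U →
      μ U = ∫⁻ a in U, ENNReal.ofReal (d a) ∂volume)
    (hinv : ∀ U : Set Cyl, U ⊆ annA → MeasurableSet U → μ (f '' U) = μ U)
    :
    ∃ a : Cyl, a ∈ annA ∧ f a = a := by
  by_contra hno
  have hFc := hFC1.continuousOn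
  have hGc := hGC1.continuousOn
  have hFm := hFbij.mapsTo
  have hne : ∀ p ∈ stripA, F p ≠ p := by
    intro p hp e
    exact hno ⟨covProj p, covProj_mem hp, by rw [← hlift p hp, e]⟩
  have hs0 : ∀ x : ℝ, (x, (0 : ℝ)) ∈ stripA := fun x => mem_stripA.2 (by norm_num)
  have hs1 : ∀ x : ℝ, (x, (1 : ℝ)) ∈ stripA := fun x => mem_stripA.2 (by norm_num)
  obtain ⟨δ, hδ, hdist⟩ := exists_delta F hper hFc hne
  have ht0 : ∀ x : ℝ, (F (x, 0)).1 ≤ x - δ := by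
    intro x
    have h := hdist _ (hs0 x)
    rw [Prod.dist_eq, Real.dist_eq, Real.dist_eq, hbdry0] at h
    simp only [sub_self, abs_zero] at h
    rw [max_eq_left (abs_nonneg _), abs_of_neg (by linarith [htwist0 x])] at h
    linarith
  have ht1 : ∀ x : ℝ, x + δ ≤ (F (x, 1)).1 := by
    intro x
    have h := hdist _ (hs1 x)
    rw [Prod.dist_eq, Real.dist_eq, Real.dist_eq, hbdry1] at h
    simp only [sub_self, abs_zero] at h
    rw [max_eq_left (abs_nonneg _), abs_of_pos (by linarith [htwist1 x])] at h
    linarith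
  -- chains in both directions
  have hup : UpChain F := by
    intro ε hε
    obtain ⟨b, hb, h⟩ := reach_all f F G hlift hper hFc hGc hFm hGmaps hGF hFG μ d hd_meas
      hd_pos hdens hinv ε hε {p | p.2 = 0} (fun p hp => mem_stripA.2 (by
        rw [mem_ofPred_eq] at hp; rw [hp]; norm_num)) ⟨(0, 0), rfl⟩ (fun n z hz => hz)
      (0, 1) (hs1 0)
    obtain ⟨n, s, h1, h2, h3, h4⟩ := chain_seq F ε b _ (mem_stripA.2 (by
        rw [mem_ofPred_eq] at hb; rw [hb]; norm_num)) h
    exact ⟨n, s, h1, by rw [h2]; exact hb, by rw [h3], h4⟩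
  have hdown : UpChain (fun z => halfTurn (F (halfTurn z))) := by
    intro ε hε
    obtain ⟨b, hb, h⟩ := reach_all f F G hlift hper hFc hGc hFm hGmaps hGF hFG μ d hd_meas
      hd_pos hdens hinv ε hε {p | p.2 = 1} (fun p hp => mem_stripA.2 (by
        rw [mem_ofPred_eq] at hp; rw [hp]; norm_num)) ⟨(0, 1), rfl⟩ (fun n z hz => hz)
      (0, 0) (hs0 0)
    rw [mem_ofPred_eq] at hb
    obtain ⟨n, s, h1, h2, h3, h4⟩ := chain_seq F ε b _ (mem_stripA.2 (by
        rw [hb]; norm_num)) h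
    refine ⟨n, fun i => halfTurn (s i), fun i => halfTurn_mem (h1 i), ?_, ?_, ?_⟩
    · simp [halfTurn, h2, hb]
    · simp [halfTurn, h3]
    · intro i hi
      simp only [halfTurn_halfTurn, dist_halfTurn]
      exact h4 i hi
  -- the angle function
  obtain ⟨θ, hθc, hθ0⟩ := exists_angle (fun z => F (clampS z) - clampS z)
    ((hFc.comp_continuous continuous_clampS clampS_mem).sub continuous_clampS)
    (fun p => sub_ne_zero.2 (hne _ (clampS_mem p)))
  have hθ : ∀ z ∈ stripA, ∃ r : ℝ, 0 < r ∧ (F z).1 - z.1 = r * Real.cos (θ z) ∧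
      (F z).2 - z.2 = r * Real.sin (θ z) := by
    intro z hz
    obtain ⟨r, hr, e1, e2⟩ := hθ0 z
    rw [clampS_of_mem hz] at e1 e2
    exact ⟨r, hr, e1, e2⟩
  obtain ⟨x, x', hx⟩ := rotation_of_chain F G hFc hGc hFm hGmaps hGF hFG hbdry0 hbdry1 δ hδ
    ht0 ht1 hdist hup θ hθc hθ
  obtain ⟨y, y', hy⟩ := rotation_of_chain (fun z => halfTurn (F (halfTurn z)))
    (fun z => halfTurn (G (halfTurn z)))
    (continuous_halfTurn.comp_continuousOn
      (hFc.comp continuous_halfTurn.continuousOn (fun z hz => halfTurn_mem hz)))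
    (continuous_halfTurn.comp_continuousOn
      (hGc.comp continuous_halfTurn.continuousOn (fun z hz => halfTurn_mem hz)))
    (fun z hz => halfTurn_mem (hFm (halfTurn_mem hz)))
    (fun z hz => halfTurn_mem (hGmaps (halfTurn_mem hz)))
    (fun p hp => by simp only [halfTurn_halfTurn]; rw [hGF _ (halfTurn_mem hp), halfTurn_halfTurn])
    (fun p hp => by simp only [halfTurn_halfTurn]; rw [hFG _ (halfTurn_mem hp), halfTurn_halfTurn])
    (fun x => by simp [halfTurn, hbdry1]) (fun x => by simp [halfTurn, hbdry0]) δ hδ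
    (fun x => by
      simp only [halfTurn, sub_zero]
      linarith [ht1 (-x)])
    (fun x => by
      simp only [halfTurn, sub_self]
      linarith [ht0 (-x)])
    (fun z hz => by
      rw [dist_halfTurn']
      exact hdist _ (halfTurn_mem hz))
    hdown (fun z => θ (halfTurn z) + Real.pi)
    ((hθc.comp continuous_halfTurn).add continuous_const)
    (fun z hz => by
      obtain ⟨r, hr, e1, e2⟩ := hθ _ (halfTurn_mem hz)
      refine ⟨r, hr, ?_, ?_⟩
      · rw [Real.cos_add_pi, mul_neg, ← e1]
        simp only [halfTurn]; ring
      · rw [Real.sin_add_pi, mul_neg, ← e2]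
        simp only [halfTurn]; ring)
  simp only [halfTurn, sub_self, sub_zero] at hy
  have hsin0 : ∀ x : ℝ, Real.sin (θ (x, 0)) = 0 := by
    intro x
    obtain ⟨r, hr, _, e2⟩ := hθ _ (hs0 x)
    rw [hbdry0] at e2
    simpa [hr.ne'] using e2
  have hsin1 : ∀ x : ℝ, Real.sin (θ (x, 1)) = 0 := by
    intro x
    obtain ⟨r, hr, _, e2⟩ := hθ _ (hs1 x)
    rw [hbdry1] at e2
    simpa [hr.ne'] using e2
  have c0 := const_of_sin_zero (fun x => θ (x, 0)) (by fun_prop) hsin0 x (-y')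
  have c1 := const_of_sin_zero (fun x => θ (x, 1)) (by fun_prop) hsin1 x' (-y)
  linarith [Real.pi_pos]
end
end

section
/- Let f be a twist map with normalized lift f̃ and let φ > 0. Then the zero set Z = {(x,y) ∈ Ã : F_φ(x,y) = 0} separates the two boundary lines of the strip: ℝ×{0} and ℝ×{1} lie in different connected components of Ã ∖ Z. -/
open Set MeasureTheory

noncomputable section

/-- `F_φ(x,y) = φ·(f̃₁(x,y) − x) − (f̃₂(x,y) − y)`, for a lift `F = f̃`. -/
def Fphi (F : ℝ × ℝ → ℝ × ℝ) (φ : ℝ) (p : ℝ × ℝ) : ℝ :=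
  φ * ((F p).1 - p.1) - ((F p).2 - p.2)

/-- For a twist map with normalized lift `f̃` and `φ > 0`, the zero set
`Z = {(x,y) ∈ Ã : F_φ(x,y) = 0}` separates the two boundary lines of the strip:
`ℝ × {0}` and `ℝ × {1}` lie in different connected components of `Ã \ Z`. -/
theorem zero_set_separates_boundary_lines
    (f : Cyl → Cyl) (F G : ℝ × ℝ → ℝ × ℝ)
    -- `F` is a lift of `f`: `π ∘ f̃ = f ∘ π`
    (hlift : ∀ p ∈ stripA, covProj (F p) = f (covProj p))
    -- equivariance of the lift: `f̃(x+1, y) = f̃(x, y) + (1, 0)`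
    (hper : ∀ p ∈ stripA, F (p.1 + 1, p.2) = ((F p).1 + 1, (F p).2))
    -- `f` is a C¹ diffeomorphism (through its lift): C¹, bijective on the strip,
    -- with a C¹ inverse lift `G`
    (hFC1 : ContDiffOn ℝ 1 F stripA)
    (hFbij : Set.BijOn F stripA stripA)
    (hGC1 : ContDiffOn ℝ 1 G stripA)
    (hGmaps : Set.MapsTo G stripA stripA)
    (hGF : ∀ p ∈ stripA, G (F p) = p)
    (hFG : ∀ p ∈ stripA, F (G p) = p)
    -- each boundary component is mapped to itself
    (hbdry0 : ∀ x : ℝ, (F (x, 0)).2 = 0)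
    (hbdry1 : ∀ x : ℝ, (F (x, 1)).2 = 1)
    -- twist condition for the normalized lift
    (htwist0 : ∀ x : ℝ, (F (x, 0)).1 < x)
    (htwist1 : ∀ x : ℝ, x < (F (x, 1)).1)
    (φ : ℝ) (hφ : 0 < φ) :
    (∀ x : ℝ, ((x, (0 : ℝ)) : ℝ × ℝ) ∈ stripA \ {p ∈ stripA | Fphi F φ p = 0}) ∧
    (∀ x : ℝ, ((x, (1 : ℝ)) : ℝ × ℝ) ∈ stripA \ {p ∈ stripA | Fphi F φ p = 0}) ∧
    (∀ x x' : ℝ,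
      connectedComponentIn (stripA \ {p ∈ stripA | Fphi F φ p = 0}) (x, 0) ≠
      connectedComponentIn (stripA \ {p ∈ stripA | Fphi F φ p = 0}) (x', 1)) := by
  have h0 : ∀ x : ℝ, Fphi F φ (x, 0) < 0 := by
    intro x
    have h1 := mul_pos hφ (sub_pos.mpr (htwist0 x))
    simp only [Fphi, hbdry0]
    nlinarith
  have h1 : ∀ x : ℝ, 0 < Fphi F φ (x, 1) := by
    intro x
    have h1 := mul_pos hφ (sub_pos.mpr (htwist1 x))
    simp only [Fphi, hbdry1]
    nlinarith
  have hm0 : ∀ x : ℝ, ((x, (0 : ℝ)) : ℝ × ℝ) ∈ stripA \ {p ∈ stripA | Fphi F φ p = 0} :=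
    fun x => ⟨by simp [stripA], fun h => (h0 x).ne h.2⟩
  have hm1 : ∀ x : ℝ, ((x, (1 : ℝ)) : ℝ × ℝ) ∈ stripA \ {p ∈ stripA | Fphi F φ p = 0} :=
    fun x => ⟨by simp [stripA], fun h => (h1 x).ne h.2.symm⟩
  refine ⟨hm0, hm1, ?_⟩
  intro x x' heq
  have hcF : ContinuousOn F stripA := hFC1.continuousOn
  have hc : ContinuousOn (Fphi F φ) stripA := by
    unfold Fphi
    fun_prop
  have hsub := connectedComponentIn_subset (stripA \ {p ∈ stripA | Fphi F φ p = 0}) (x, 0)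
  have ha := mem_connectedComponentIn (hm0 x)
  have hb := mem_connectedComponentIn (hm1 x')
  rw [← heq] at hb
  obtain ⟨p, hp, hp0⟩ := isPreconnected_connectedComponentIn.intermediate_value ha hb
    (hc.mono (hsub.trans diff_subset)) ⟨(h0 x).le, (h1 x').le⟩
  exact (hsub hp).2 ⟨(hsub hp).1, hp0⟩
end
end

section
/- Let S ⊆ (ℝ/ℤ) × (0,1) be a subset of the open annulus that is homeomorphic to the unit circle, and suppose that f preserves the x-coordinate on S, i.e. f̃₁(x,y) = x for every (x,y) ∈ π⁻¹(S). If there exist points p = (p₁,p₂) and q = (q₁,q₂) in π⁻¹(S) with f̃₂(p) > p₂ and f̃₂(q) < q₂, then f has at least two fixed points lying on S. -/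
open Set MeasureTheory

noncomputable section

theorem circle_two_zeros (g : Circle → ℝ) (hg : Continuous g) (u v : Circle)
    (hu : 0 < g u) (hv : g v < 0) : ∃ a b : Circle, g a = 0 ∧ g b = 0 ∧ a ≠ b := by
  obtain ⟨s, rfl⟩ : ∃ s, Circle.exp s = u := ⟨_, Circle.exp_arg u⟩
  obtain ⟨t, hst, ht2, rfl⟩ : ∃ t, s ≤ t ∧ t < s + 2 * Real.pi ∧ Circle.exp t = v := by
    have hm := toIcoMod_mem_Ico Real.two_pi_pos s (Complex.arg v)
    refine ⟨toIcoMod Real.two_pi_pos s (Complex.arg v), hm.1, hm.2, ?_⟩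
    refine Eq.trans ?_ (Circle.exp_arg v)
    rw [Circle.exp_eq_exp]
    refine ⟨-toIcoDiv Real.two_pi_pos s (Complex.arg v), ?_⟩
    rw [toIcoMod]
    push_cast
    simp only [zsmul_eq_mul]
    ring
  have hc : Continuous (fun x : ℝ => g (Circle.exp x)) := hg.comp Circle.exp.continuous
  have hper : Circle.exp (s + 2 * Real.pi) = Circle.exp s := by
    rw [Circle.exp_eq_exp]
    exact ⟨1, by push_cast; ring⟩
  obtain ⟨c, hc1, hc2⟩ := intermediate_value_Ioo' hst hc.continuousOn
    (show (0 : ℝ) ∈ Set.Ioo _ _ from ⟨hv, hu⟩)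
  obtain ⟨d, hd1, hd2⟩ := intermediate_value_Ioo ht2.le hc.continuousOn
    (show (0 : ℝ) ∈ Set.Ioo _ _ from ⟨hv, by simpa only [hper] using hu⟩)
  refine ⟨_, _, hc2, hd2, fun h => ?_⟩
  obtain ⟨m, hm⟩ := Circle.exp_eq_exp.1 h.symm
  have hpi := Real.two_pi_pos
  obtain ⟨h1, h2⟩ := hc1
  obtain ⟨h3, h4⟩ := hd1
  have m0 : (0 : ℝ) < m := by
    by_contra hh
    have := mul_nonneg (neg_nonneg.2 (not_lt.1 hh)) hpi.le
    linarith
  have m1 : (m : ℝ) < 1 := by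
    by_contra hh
    have := mul_le_mul_of_nonneg_right (not_lt.1 hh) hpi.le
    linarith
  have : 0 < m := by exact_mod_cast m0
  have : m < 1 := by exact_mod_cast m1
  omega

/-- If `S` is an embedded circle in the open annulus on which `f` preserves the
`x`-coordinate (i.e. `f̃₁(x,y) = x` on `π⁻¹(S)`), and some point of `π⁻¹(S)` moves strictly
up while another moves strictly down under `f̃`, then `f` has at least two fixed points
lying on `S`. -/
theorem two_fixed_points_on_x_invariant_circle
    (f : Cyl → Cyl) (F G : ℝ × ℝ → ℝ × ℝ)
    -- `F` is a lift of `f`: `π ∘ f̃ = f ∘ π`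
    (hlift : ∀ p ∈ stripA, covProj (F p) = f (covProj p))
    -- equivariance of the lift: `f̃(x+1, y) = f̃(x, y) + (1, 0)`
    (hper : ∀ p ∈ stripA, F (p.1 + 1, p.2) = ((F p).1 + 1, (F p).2))
    -- `f` is a C¹ diffeomorphism (through its lift): C¹, bijective on the strip,
    -- with a C¹ inverse lift `G`
    (hFC1 : ContDiffOn ℝ 1 F stripA)
    (hFbij : Set.BijOn F stripA stripA)
    (hGC1 : ContDiffOn ℝ 1 G stripA)
    (hGmaps : Set.MapsTo G stripA stripA)
    (hGF : ∀ p ∈ stripA, G (F p) = p)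
    (hFG : ∀ p ∈ stripA, F (G p) = p)
    -- each boundary component is mapped to itself
    (hbdry0 : ∀ x : ℝ, (F (x, 0)).2 = 0)
    (hbdry1 : ∀ x : ℝ, (F (x, 1)).2 = 1)
    -- `S` is a subset of the open annulus homeomorphic to the unit circle
    (S : Set Cyl) (hS : S ⊆ Set.univ ×ˢ Set.Ioo (0 : ℝ) 1)
    (hScircle : Nonempty (S ≃ₜ Circle))
    -- `f` preserves the `x`-coordinate on `S`
    (hxinv : ∀ p ∈ stripA, covProj p ∈ S → (F p).1 = p.1)
    -- a point of `π⁻¹(S)` moving up and a point moving down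
    (p : ℝ × ℝ) (hp : p ∈ stripA) (hpS : covProj p ∈ S) (hpup : p.2 < (F p).2)
    (q : ℝ × ℝ) (hq : q ∈ stripA) (hqS : covProj q ∈ S) (hqdown : (F q).2 < q.2) :
    ∃ a b : Cyl, a ∈ S ∧ b ∈ S ∧ f a = a ∧ f b = b ∧ a ≠ b := by
  obtain ⟨e⟩ := hScircle
  -- lifts of points of `S`
  have hrep : ∀ a ∈ S, ∃ r ∈ stripA, covProj r = a := by
    rintro ⟨x, y⟩ ha
    obtain ⟨x, rfl⟩ := QuotientAddGroup.mk_surjective x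
    exact ⟨(x, y), ⟨mem_univ _, Ioo_subset_Icc_self (hS ha).2⟩, rfl⟩
  -- continuity of the second coordinate of `f` on `S`
  let k : ℝ → ℝ := fun y => (Set.projIcc (0 : ℝ) 1 zero_le_one y : ℝ)
  have hk : Continuous k := continuous_subtype_val.comp continuous_projIcc
  have hkmem : ∀ y, k y ∈ Icc (0 : ℝ) 1 := fun y => (Set.projIcc (0 : ℝ) 1 zero_le_one y).2
  have hkeq : ∀ y ∈ Icc (0 : ℝ) 1, k y = y := fun y hy => by
    simp only [k, Set.projIcc_of_mem zero_le_one hy]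
  have hq' : IsOpenQuotientMap covProj :=
    (QuotientAddGroup.isOpenQuotientMap_mk (N := AddSubgroup.zmultiples (1 : ℝ))).prodMap
      IsOpenQuotientMap.id
  have hcont : Continuous (fun a : Cyl => (f (a.1, k a.2)).2) := by
    rw [hq'.isQuotientMap.continuous_iff]
    have : (fun a : Cyl => (f (a.1, k a.2)).2) ∘ covProj
        = fun r : ℝ × ℝ => (F (r.1, k r.2)).2 := by
      funext r
      have := hlift (r.1, k r.2) ⟨mem_univ _, hkmem _⟩
      exact (congrArg Prod.snd this).symm
    rw [this]
    refine continuous_snd.comp (hFC1.continuousOn.comp_continuous (by fun_prop) ?_)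
    exact fun r => ⟨mem_univ _, hkmem _⟩
  let g : S → ℝ := fun a => (f (a.1.1, k a.1.2)).2 - a.1.2
  have hg : Continuous g := by
    refine (hcont.comp continuous_subtype_val).sub (by fun_prop)
  have hgval : ∀ r ∈ stripA, ∀ h : covProj r ∈ S, g ⟨covProj r, h⟩ = (F r).2 - r.2 := by
    intro r hr h
    have h1 : (f (covProj r)).2 = (F r).2 := (congrArg Prod.snd (hlift r hr)).symm
    have h2 : k r.2 = r.2 := hkeq _ hr.2
    change (f ((covProj r).1, k r.2)).2 - r.2 = _
    rw [h2, ← h1]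
    rfl
  have hfix : ∀ a : S, g a = 0 → f a = a := by
    rintro ⟨a, ha⟩ h0
    obtain ⟨r, hr, rfl⟩ := hrep a ha
    rw [hgval r hr ha] at h0
    change f (covProj r) = covProj r
    rw [← hlift r hr]
    congr 1
    exact Prod.ext (hxinv r hr ha) (by linarith)
  obtain ⟨a, b, ha, hb, hab⟩ := circle_two_zeros (g ∘ e.symm) (hg.comp e.symm.continuous)
    (e ⟨_, hpS⟩) (e ⟨_, hqS⟩)
    (by simp only [Function.comp, e.symm_apply_apply]; rw [hgval p hp]; linarith)
    (by simp only [Function.comp, e.symm_apply_apply]; rw [hgval q hq]; linarith)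
  exact ⟨e.symm a, e.symm b, (e.symm a).2, (e.symm b).2, hfix _ ha, hfix _ hb,
    fun h => hab (e.symm.injective (Subtype.ext h))⟩
end
end
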